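/- Let α, β, γ be integers and let n, k, ℓ be nonnegative integers. Then k! · S^{γ,α,β}_{n,k,ℓ} = Σ over all tuples (r_1, …, r_{k+1}) of nonnegative integers with r_1 + ⋯ + r_{k+1} = n and r_1, …, r_k ≥ 1, of the multinomial coefficient n!/(r_1!⋯r_{k+1}!) times γ^{r_{k+1}} · ∏_{i=1}^{k} S^{0,α,β}_{r_i,1,ℓ}. -/

import Mathlib

open Finset
open scoped Classical

/-- Degenerate falling factorial `(t)_{m,λ} = t(t-λ)⋯(t-(m-1)λ)`. -/
def dff {R : Type*} [CommRing R] (t : R) (m : ℕ) (lam : R) : R :=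
  ∏ i ∈ Finset.range m, (t - (i : R) * lam)

/-- `P` is a set partition of the finset `S` into `k` nonempty blocks. -/
def IsPartitionInto {n : ℕ} (S : Finset (Fin n)) (k : ℕ)
    (P : Finset (Finset (Fin n))) : Prop :=
  P.card = k ∧ (∀ B ∈ P, B.Nonempty) ∧
    (∀ B ∈ P, ∀ C ∈ P, B ≠ C → Disjoint B C) ∧ P.sup id = S

/-- Generalized Stirling number `S_{α,β,γ}(n,k)`: weighted sum over pairs `(G,P)`
where `G ⊆ [n]` and `P` partitions `[n] \ G` into `k` nonempty blocks, with weight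
`(γ)_{|G|,α} · ∏_{B∈P} (β-α)_{|B|-1,α}`. -/
noncomputable def genStirling {R : Type*} [CommRing R] (a b g : R) (n k : ℕ) : R :=
  ∑ G : Finset (Fin n),
    ∑ P ∈ Finset.univ.filter (fun P => IsPartitionInto Gᶜ k P),
      dff g G.card a * ∏ B ∈ P, dff (b - a) (B.card - 1) a

/-- Restricted generalized Stirling number `S^{≤ℓ}_{α,β,γ}(n,k)`:
as `genStirling` but every block of `P` has at most `ℓ` elements. -/
noncomputable def genStirlingLe {R : Type*} [CommRing R] (a b g : R) (n k l : ℕ) : R :=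
  ∑ G : Finset (Fin n),
    ∑ P ∈ Finset.univ.filter
        (fun P => IsPartitionInto Gᶜ k P ∧ ∀ B ∈ P, B.card ≤ l),
      dff g G.card a * ∏ B ∈ P, dff (b - a) (B.card - 1) a

/-- `S^{>ℓ}_γ(n,k)`: weighted sum over pairs `(G,P)` where `P` partitions
`[n] \ G` into `k` nonempty blocks each of size `> ℓ`, with weight `γ^{|G|}`. -/
noncomputable def Sgt {R : Type*} [CommRing R] (g : R) (n k l : ℕ) : R :=
  ∑ G : Finset (Fin n),
    ∑ _P ∈ Finset.univ.filter
        (fun P : Finset (Finset (Fin n)) =>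
          IsPartitionInto Gᶜ k P ∧ ∀ B ∈ P, l < B.card),
      g ^ G.card

/-- Associated Stirling number of the second kind `S_{≥ℓ}(n,k)`: the number of
set partitions of `[n]` into `k` nonempty blocks each of size at least `ℓ`. -/
noncomputable def assocStirling (n k l : ℕ) : ℕ :=
  (Finset.univ.filter
    (fun P : Finset (Finset (Fin n)) =>
      IsPartitionInto Finset.univ k P ∧ ∀ B ∈ P, l ≤ B.card)).card

/-- Partial degenerate partition number `S^{γ,α,β}_{n,k,ℓ}`: weighted sum over
pairs `(G,P)` with weight `γ^{|G|} · ∏_{B∈P, |B|≤ℓ} (β-α)_{|B|-1,α}`. -/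
noncomputable def partialS {R : Type*} [CommRing R] (g a b : R) (n k l : ℕ) : R :=
  ∑ G : Finset (Fin n),
    ∑ P ∈ Finset.univ.filter (fun P => IsPartitionInto Gᶜ k P),
      g ^ G.card * ∏ B ∈ P, (if B.card ≤ l then dff (b - a) (B.card - 1) a else 1)

/-- `S^{≤ℓ}_{α,β}(n,k)`: sum over set partitions of `[n]` into `k` nonempty blocks
each with at most `ℓ` elements, of the weight `∏_{B∈P} (β-α)_{|B|-1,α}`. -/
noncomputable def SleRestr {R : Type*} [CommRing R] (a b : R) (n k l : ℕ) : R :=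
  ∑ P ∈ Finset.univ.filter
      (fun P : Finset (Finset (Fin n)) =>
        IsPartitionInto Finset.univ k P ∧ ∀ B ∈ P, B.card ≤ l),
    ∏ B ∈ P, dff (b - a) (B.card - 1) a

/-- The contribution of a block of size `m` to the weight in `partialS`. -/
noncomputable def blockWeight {R : Type*} [CommRing R] (a b : R) (l m : ℕ) : R :=
  if m ≤ l then dff (b - a) (m - 1) a else 1

theorem partialS_eq_sum {R : Type*} [CommRing R] (g a b : R) (n k l : ℕ) :
    partialS g a b n k l =
      ∑ P ∈ Finset.univ.filter
          (fun P : Finset (Finset (Fin n)) => IsPartitionInto (P.sup id) k P),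
        g ^ (P.sup id)ᶜ.card * ∏ B ∈ P, blockWeight a b l B.card := by
  simp only [partialS, Finset.sum_filter]
  rw [Finset.sum_comm]
  refine Finset.sum_congr rfl fun P _ => ?_
  rw [Finset.sum_eq_single (P.sup id)ᶜ]
  · rw [compl_compl]
    rfl
  · intro G _ hG
    rw [if_neg]
    rintro ⟨-, -, -, h⟩
    exact hG (by rw [h, compl_compl])
  · simp

theorem partialS_zero_one {R : Type*} [CommRing R] (a b : R) (l : ℕ) {r : ℕ} (hr : 1 ≤ r) :
    partialS 0 a b r 1 l = blockWeight a b l r := by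
  have : Nonempty (Fin r) := ⟨⟨0, hr⟩⟩
  rw [partialS_eq_sum, Finset.sum_eq_single {Finset.univ}]
  · simp
  · intro P hP hne
    obtain ⟨hc, -⟩ := (Finset.mem_filter.1 hP).2
    obtain ⟨B, rfl⟩ := Finset.card_eq_one.1 hc
    have hB : Bᶜ.card ≠ 0 := by
      rw [Ne, Finset.card_eq_zero, Finset.compl_eq_empty_iff]
      rintro rfl
      exact hne rfl
    simp [zero_pow hB]
  · intro h
    refine absurd (Finset.mem_filter.2 ⟨Finset.mem_univ _, ?_⟩) h
    simp [IsPartitionInto]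

/-- The set of elements that a colouring `c` sends to colour `i`. -/
def colourClass {n m : ℕ} (c : Fin n → Fin m) (i : Fin m) : Finset (Fin n) :=
  Finset.univ.filter (fun j => c j = i)

@[simp]
theorem mem_colourClass {n m : ℕ} {c : Fin n → Fin m} {i : Fin m} {j : Fin n} :
    j ∈ colourClass c i ↔ c j = i := by
  simp [colourClass]

theorem disjoint_colourClass {n m : ℕ} (c : Fin n → Fin m) {i i' : Fin m} (h : i ≠ i') :
    Disjoint (colourClass c i) (colourClass c i') := by
  rw [Finset.disjoint_left]
  intro j hj hj'
  rw [mem_colourClass] at hj hj'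
  exact h (hj.symm.trans hj')

theorem eq_of_colourClass_castSucc_eq {n k : ℕ} {c c' : Fin n → Fin (k + 1)}
    (h : ∀ i : Fin k, colourClass c i.castSucc = colourClass c' i.castSucc) : c = c' := by
  have key : ∀ j (i : Fin k), c j = i.castSucc ↔ c' j = i.castSucc := fun j i => by
    rw [← mem_colourClass, h, mem_colourClass]
  funext j
  rcases Fin.eq_castSucc_or_eq_last (c j) with ⟨i, hi⟩ | hl
  · rw [hi, (key j i).1 hi]
  · rcases Fin.eq_castSucc_or_eq_last (c' j) with ⟨i, hi⟩ | hl'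
    · rw [hi, (key j i).2 hi]
    · rw [hl, hl']

theorem exists_colourClass_castSucc_eq {n k : ℕ} (B : Fin k → Finset (Fin n))
    (hB : ∀ i i', i ≠ i' → Disjoint (B i) (B i')) :
    ∃ c : Fin n → Fin (k + 1), ∀ i : Fin k, colourClass c i.castSucc = B i := by
  refine ⟨fun j => if h : ∃ i, j ∈ B i then h.choose.castSucc else Fin.last k, fun i => ?_⟩
  ext j
  rw [mem_colourClass]
  split_ifs with h
  · rw [Fin.castSucc_inj]
    constructor
    · rintro rfl
      exact h.choose_spec
    · intro hj
      by_contra hne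
      exact Finset.disjoint_left.1 (hB _ _ hne) h.choose_spec hj
  · exact ⟨fun hl => absurd hl.symm (Fin.castSucc_ne_last i), fun hj => absurd ⟨i, hj⟩ h⟩

/-- The colour classes of `c` other than the one of the last colour. -/
noncomputable def colourBlocks {n k : ℕ} (c : Fin n → Fin (k + 1)) : Finset (Finset (Fin n)) :=
  Finset.univ.image fun i : Fin k => colourClass c i.castSucc

/-- The colourings in which every colour except possibly the last one is used. -/
noncomputable def fullColourings (n k : ℕ) : Finset (Fin n → Fin (k + 1)) :=
  Finset.univ.filter fun c => ∀ i : Fin k, (colourClass c i.castSucc).Nonempty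

theorem mem_fullColourings {n k : ℕ} {c : Fin n → Fin (k + 1)} :
    c ∈ fullColourings n k ↔ ∀ i : Fin k, (colourClass c i.castSucc).Nonempty := by
  simp [fullColourings]

theorem injective_colourClass_castSucc {n k : ℕ} {c : Fin n → Fin (k + 1)}
    (hc : c ∈ fullColourings n k) :
    Function.Injective fun i : Fin k => colourClass c i.castSucc := by
  intro i i' h
  obtain ⟨j, hj⟩ := mem_fullColourings.1 hc i
  have hj' : j ∈ colourClass c i'.castSucc := by
    rw [← show colourClass c i.castSucc = colourClass c i'.castSucc from h]
    exact hj
  rw [mem_colourClass] at hj hj'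
  exact Fin.castSucc_injective k (hj.symm.trans hj')

theorem sup_colourBlocks {n k : ℕ} (c : Fin n → Fin (k + 1)) :
    (colourBlocks c).sup id = (colourClass c (Fin.last k))ᶜ := by
  ext j
  rw [colourBlocks, Finset.sup_image, Finset.mem_sup, Finset.mem_compl, mem_colourClass]
  rcases Fin.eq_castSucc_or_eq_last (c j) with ⟨i, hi⟩ | hl
  · simp [hi, Fin.castSucc_ne_last]
  · simp [hl, (Fin.castSucc_ne_last _).symm]

theorem isPartitionInto_colourBlocks {n k : ℕ} {c : Fin n → Fin (k + 1)}
    (hc : c ∈ fullColourings n k) :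
    IsPartitionInto ((colourBlocks c).sup id) k (colourBlocks c) := by
  refine ⟨?_, ?_, ?_, rfl⟩
  · rw [colourBlocks, Finset.card_image_of_injective _ (injective_colourClass_castSucc hc),
      Finset.card_univ, Fintype.card_fin]
  · intro B hB
    obtain ⟨i, -, rfl⟩ := Finset.mem_image.1 hB
    exact mem_fullColourings.1 hc i
  · intro B hB C hC hne
    obtain ⟨i, -, rfl⟩ := Finset.mem_image.1 hB
    obtain ⟨i', -, rfl⟩ := Finset.mem_image.1 hC
    exact disjoint_colourClass c fun h => hne (by rw [h])

theorem card_filter_colourBlocks_eq {n k : ℕ} {P : Finset (Finset (Fin n))}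
    (hP : IsPartitionInto (P.sup id) k P) :
    ((fullColourings n k).filter fun c => colourBlocks c = P).card = k.factorial := by
  obtain ⟨hcard, hne, hdisj, -⟩ := hP
  have hequiv : Fintype.card (Fin k ≃ P) = k.factorial := by
    rw [Fintype.card_equiv (P.equivFinOfCardEq hcard).symm, Fintype.card_fin]
  rw [← hequiv, ← Finset.card_univ]
  have hmem : ∀ c ∈ (fullColourings n k).filter fun c => colourBlocks c = P,
      ∀ i : Fin k, colourClass c i.castSucc ∈ P := fun c hc i => by
    rw [← (Finset.mem_filter.1 hc).2]
    exact Finset.mem_image_of_mem _ (Finset.mem_univ i)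
  refine Finset.card_bij
    (fun c hc => Equiv.ofBijective (fun i : Fin k => (⟨_, hmem c hc i⟩ : P)) ⟨?_, ?_⟩)
    (fun _ _ => Finset.mem_univ _) ?_ ?_
  · intro i i' h
    exact injective_colourClass_castSucc (Finset.mem_filter.1 hc).1 (congrArg Subtype.val h)
  · rintro ⟨B, hB⟩
    rw [← (Finset.mem_filter.1 hc).2] at hB
    obtain ⟨i, -, rfl⟩ := Finset.mem_image.1 hB
    exact ⟨i, rfl⟩
  · intro c hc c' hc' h
    exact eq_of_colourClass_castSucc_eq fun i => congrArg Subtype.val (DFunLike.congr_fun h i)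
  · intro e _
    obtain ⟨c, hc⟩ := exists_colourClass_castSucc_eq (fun i => (e i : Finset (Fin n)))
      fun i i' hi => hdisj _ (e i).2 _ (e i').2 fun h => hi (e.injective (Subtype.ext h))
    refine ⟨c, Finset.mem_filter.2 ⟨mem_fullColourings.2 fun i => ?_, ?_⟩, ?_⟩
    · rw [hc]
      exact hne _ (e i).2
    · ext B
      simp only [colourBlocks, hc, Finset.mem_image, Finset.mem_univ, true_and]
      constructor
      · rintro ⟨i, rfl⟩
        exact (e i).2
      · intro hB
        exact ⟨e.symm ⟨B, hB⟩, by simp⟩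
    · ext1 i
      exact Subtype.ext (hc i)

theorem factorial_mul_partialS {R : Type*} [CommRing R] (g a b : R) (n k l : ℕ) :
    (k.factorial : R) * partialS g a b n k l =
      ∑ c ∈ fullColourings n k, g ^ (colourClass c (Fin.last k)).card *
        ∏ i : Fin k, blockWeight a b l (colourClass c i.castSucc).card := by
  rw [partialS_eq_sum, Finset.mul_sum, ← Finset.sum_fiberwise_of_maps_to
    (g := colourBlocks)
    (t := Finset.univ.filter
      (fun P : Finset (Finset (Fin n)) => IsPartitionInto (P.sup id) k P))
    fun c hc => Finset.mem_filter.2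
      ⟨Finset.mem_univ _, isPartitionInto_colourBlocks hc⟩]
  refine Finset.sum_congr rfl fun P hP => ?_
  rw [← card_filter_colourBlocks_eq (Finset.mem_filter.1 hP).2, ← nsmul_eq_mul,
    ← Finset.sum_const]
  refine Finset.sum_congr rfl fun c hc => ?_
  obtain ⟨hfull, rfl⟩ := Finset.mem_filter.1 hc
  rw [sup_colourBlocks, compl_compl, colourBlocks,
    Finset.prod_image (injective_colourClass_castSucc hfull).injOn]

/-- The multinomial coefficient counts colourings with prescribed sizes of colour classes. -/
theorem card_colourings_eq_multinomial {n m : ℕ} {r : Fin m → ℕ} (hr : ∑ i, r i = n) :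
    (Finset.univ.filter fun c : Fin n → Fin m => (fun i => (colourClass c i).card) = r).card =
      Nat.multinomial Finset.univ r := by
  have hmon : ∀ s : Fin m → ℕ, ∏ i, (MvPolynomial.X i : MvPolynomial (Fin m) ℕ) ^ s i =
      MvPolynomial.monomial (Finsupp.equivFunOnFinite.symm s) 1 := fun s => by
    rw [MvPolynomial.monomial_eq, Finsupp.prod_fintype _ _ fun _ => pow_zero _]
    simp
  have hleft : (∑ i, (MvPolynomial.X i : MvPolynomial (Fin m) ℕ)) ^ n =
      ∑ c : Fin n → Fin m, MvPolynomial.monomial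
        (Finsupp.equivFunOnFinite.symm fun i => (colourClass c i).card) 1 := by
    rw [← Fin.prod_const, Finset.prod_univ_sum, Fintype.piFinset_univ]
    refine Finset.sum_congr rfl fun c _ => ?_
    rw [← hmon, ← Finset.prod_fiberwise (s := Finset.univ) (g := c)]
    refine Finset.prod_congr rfl fun i _ => ?_
    rw [Finset.prod_congr rfl fun j hj => by rw [(Finset.mem_filter.1 hj).2],
      Finset.prod_const]
    rfl
  have h := congrArg (MvPolynomial.coeff (Finsupp.equivFunOnFinite.symm r))
    (hleft.symm.trans (Finset.sum_pow_eq_sum_piAntidiag _ _ _))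
  simp only [hmon, MvPolynomial.coeff_sum, MvPolynomial.coeff_monomial,
    EmbeddingLike.apply_eq_iff_eq, ← nsmul_eq_mul, MvPolynomial.coeff_smul] at h
  rw [Finset.card_filter, h, Finset.sum_eq_single r]
  · simp
  · intro s _ hs
    simp [hs]
  · intro hr'
    exact absurd (Finset.mem_piAntidiag.2 ⟨hr, fun _ _ => Finset.mem_univ _⟩) hr'

theorem sum_card_colourClass {n m : ℕ} (c : Fin n → Fin m) :
    ∑ i, (colourClass c i).card = n := by
  have h := Finset.card_eq_sum_card_fiberwise (f := c) (s := Finset.univ) (t := Finset.univ)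
    fun _ _ => Finset.mem_coe.2 (Finset.mem_univ _)
  rw [Finset.card_univ, Fintype.card_fin] at h
  exact h.symm

theorem stmt10 (a b g : ℤ) (n k l : ℕ) :
    (k.factorial : ℤ) * partialS g a b n k l =
      ∑ r ∈ (Finset.Nat.antidiagonalTuple (k + 1) n).filter
          (fun r => ∀ i : Fin k, 1 ≤ r i.castSucc),
        (Nat.multinomial Finset.univ r : ℤ) * g ^ r (Fin.last k) *
          ∏ i : Fin k, partialS (0 : ℤ) a b (r i.castSucc) 1 l := by
  rw [factorial_mul_partialS, ← Finset.sum_fiberwise_of_maps_to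
    (g := fun c i => (colourClass c i).card)
    (t := (Finset.Nat.antidiagonalTuple (k + 1) n).filter
      (fun r => ∀ i : Fin k, 1 ≤ r i.castSucc))
    fun c hc => Finset.mem_filter.2
      ⟨Finset.Nat.mem_antidiagonalTuple.2 (sum_card_colourClass c),
        fun i => Finset.card_pos.2 (mem_fullColourings.1 hc i)⟩]
  refine Finset.sum_congr rfl fun r hr => ?_
  obtain ⟨hsum, hpos⟩ := Finset.mem_filter.1 hr
  have hfull : (fullColourings n k).filter (fun c => (fun i => (colourClass c i).card) = r) =
      Finset.univ.filter (fun c => (fun i => (colourClass c i).card) = r) := by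
    ext c
    simp only [Finset.mem_filter, Finset.mem_univ, true_and, and_iff_right_iff_imp]
    rintro rfl
    exact mem_fullColourings.2 fun i => Finset.card_pos.1 (hpos i)
  rw [hfull, ← card_colourings_eq_multinomial (Finset.Nat.mem_antidiagonalTuple.1 hsum),
    mul_assoc, ← nsmul_eq_mul, ← Finset.sum_const]
  refine Finset.sum_congr rfl fun c hc => ?_
  obtain rfl := (Finset.mem_filter.1 hc).2
  rw [Finset.prod_congr rfl fun i _ => partialS_zero_one a b l (hpos i)]
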